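/- Let N ∈ ℕ, b ∈ ℂ^N, σ > 0, F_s > 0, and fix 0 ≤ j < N, a sign e ∈ {-1,1} and signs x*_0,…,x*_{j-1} ∈ {-1,1}. For a uniform random X ∈ {-1,1}^{N-j-1}, let Y(X) = (x*_0,…,x*_{j-1}, e, X_0,…,X_{N-j-2}) ∈ {-1,1}^N and let û(t) = u(t, b⊙Y(X)) − E[u(t, b⊙Y(X))] be the centered continuous-time OFDM signal. Then for all t₁, t₂ ∈ ℝ, E[Re û(t₁) · Im û(t₂)] = (N σ²)^{-1} Σ_{k=j+1}^{N-1} Re(b_k e^{i ω_k t₁}) · Im(b_k e^{i ω_k t₂}), where ω_k = 2π F_s k / N. -/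

import Mathlib

open Finset

/-- The two-element set of signs `{-1, 1} ⊆ ℝ`. -/
noncomputable def signFS : Finset ℝ := {-1, 1}

/-- Continuous-time OFDM symbol `u(t, b) = (σ√N)⁻¹ Σ_k b_k exp(2πi F_s k t / N)`. -/
noncomputable def uCont (N : ℕ) (σ Fs : ℝ) (b : Fin N → ℂ) (t : ℝ) : ℂ :=
  ((σ : ℂ) * ((Real.sqrt N : ℝ) : ℂ))⁻¹ *
    ∑ k : Fin N, b k *
      Complex.exp (2 * (Real.pi : ℂ) * Complex.I * (Fs : ℂ) * ((k : ℕ) : ℂ) * (t : ℂ) / (N : ℂ))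

/-- A sum over sign vectors of a function that is odd under flipping one coordinate vanishes. -/
lemma sum_signs_eq_zero_of_flip {ι : Type*} [Fintype ι] [DecidableEq ι] (i : ι)
    (f : (ι → ℝ) → ℝ) (hf : ∀ x : ι → ℝ, f (Function.update x i (-x i)) = -f x) :
    ∑ X : ι → signFS, f (fun k => (X k : ℝ)) = 0 := by
  have hneg : ∀ x : signFS, -(x : ℝ) ∈ signFS := by
    rintro ⟨x, hx⟩
    simp only [signFS, Finset.mem_insert, Finset.mem_singleton] at hx ⊢
    rcases hx with rfl | rfl <;> simp
  let flip : (ι → signFS) → (ι → signFS) := fun X => Function.update X i ⟨-(X i : ℝ), hneg _⟩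
  have hflip : Function.Involutive flip := by
    intro X
    ext k
    by_cases hk : k = i
    · subst hk
      simp [flip]
    · simp [flip, hk]
  have hodd : ∀ X, f (fun k => (flip X k : ℝ)) = -f (fun k => (X k : ℝ)) := by
    intro X
    rw [← hf]
    congr 1
    ext k
    by_cases hk : k = i
    · subst hk
      simp [flip]
    · simp [flip, hk]
  have h := Equiv.sum_comp hflip.toPerm (fun X => f (fun k => (X k : ℝ)))
  simp only [Function.Involutive.coe_toPerm, hodd, Finset.sum_neg_distrib] at h
  linarith

lemma sum_signs_apply {ι : Type*} [Fintype ι] [DecidableEq ι] (i : ι) :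
    ∑ X : ι → signFS, (X i : ℝ) = 0 :=
  sum_signs_eq_zero_of_flip i (fun x => x i) (by simp)

lemma sum_signs_mul {ι : Type*} [Fintype ι] [DecidableEq ι] (i l : ι) :
    ∑ X : ι → signFS, (X i : ℝ) * (X l : ℝ) =
      if i = l then (Fintype.card (ι → signFS) : ℝ) else 0 := by
  split_ifs with h
  · subst h
    have hsq : ∀ x : signFS, (x : ℝ) * x = 1 := by
      rintro ⟨x, hx⟩
      simp only [signFS, Finset.mem_insert, Finset.mem_singleton] at hx
      rcases hx with rfl | rfl <;> simp
    simp only [hsq, Finset.sum_const, Finset.card_univ, nsmul_eq_mul, mul_one]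
  · exact sum_signs_eq_zero_of_flip i (fun x => x i * x l) (fun x => by
      simp [Function.update_of_ne (Ne.symm h)])

/-- The OFDM symbol as a linear combination of real sign factors. -/
lemma uCont_mul_ofReal (N : ℕ) (σ Fs : ℝ) (b : Fin N → ℂ) (y : Fin N → ℝ) (t : ℝ) :
    uCont N σ Fs (fun k => b k * ((y k : ℝ) : ℂ)) t =
      ∑ k, ((y k * (σ * √(N : ℝ))⁻¹ : ℝ) : ℂ) * (b k * Complex.exp (Complex.I *
        ((2 * Real.pi * Fs * ((k : ℕ) : ℝ) / (N : ℝ) : ℝ) : ℂ) * (t : ℂ))) := by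
  rw [uCont, Finset.mul_sum]
  refine Finset.sum_congr rfl fun k _ => ?_
  have h : 2 * (Real.pi : ℂ) * Complex.I * (Fs : ℂ) * ((k : ℕ) : ℂ) * (t : ℂ) / (N : ℂ) =
      Complex.I * ((2 * Real.pi * Fs * ((k : ℕ) : ℝ) / (N : ℝ) : ℝ) : ℂ) * (t : ℂ) := by
    push_cast
    ring
  rw [h]
  push_cast
  ring

/-- Centering a random real linear combination removes the deterministic part of the
coefficients. -/
lemma sum_sub_average {Ω κ : Type*} [Fintype Ω] [Nonempty Ω] [Fintype κ] (r : ℝ)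
    (F : κ → ℝ) (Z : Ω → κ → ℝ) (hZ : ∀ k, ∑ X, Z X k = 0) (a : κ → ℂ) (X : Ω) :
    ∑ k, (((F k + Z X k) * r : ℝ) : ℂ) * a k -
        (Fintype.card Ω : ℂ)⁻¹ * ∑ X', ∑ k, (((F k + Z X' k) * r : ℝ) : ℂ) * a k =
      ∑ k, ((r * Z X k : ℝ) : ℂ) * a k := by
  have hmean : ∀ k, ∑ X', (((F k + Z X' k) * r : ℝ) : ℂ) =
      (Fintype.card Ω : ℂ) * ((F k * r : ℝ) : ℂ) := by
    intro k
    rw [← Complex.ofReal_sum, ← Finset.sum_mul, Finset.sum_add_distrib, hZ]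
    simp [mul_assoc]
  have hcard : (Fintype.card Ω : ℂ) ≠ 0 := Nat.cast_ne_zero.mpr Fintype.card_ne_zero
  rw [Finset.sum_comm, Finset.mul_sum, ← Finset.sum_sub_distrib]
  refine Finset.sum_congr rfl fun k _ => ?_
  rw [← Finset.sum_mul, hmean, mul_assoc, inv_mul_cancel_left₀ hcard]
  push_cast
  ring

/-- Covariance of two real linear combinations of uncorrelated coefficients. -/
lemma average_sum_mul_sum {Ω κ : Type*} [Fintype Ω] [Nonempty Ω] [Fintype κ] [DecidableEq κ]
    (p : κ → Prop) [DecidablePred p] (r : ℝ) (Z : Ω → κ → ℝ)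
    (hZ : ∀ k l, ∑ X, Z X k * Z X l = if k = l ∧ p k then (Fintype.card Ω : ℝ) else 0)
    (f g : κ → ℝ) :
    (Fintype.card Ω : ℝ)⁻¹ * ∑ X, (∑ k, r * Z X k * f k) * (∑ k, r * Z X k * g k) =
      r ^ 2 * ∑ k ∈ Finset.univ.filter p, f k * g k := by
  have hcard : (Fintype.card Ω : ℝ) ≠ 0 := Nat.cast_ne_zero.mpr Fintype.card_ne_zero
  have hswap : ∑ X, (∑ k, r * Z X k * f k) * (∑ k, r * Z X k * g k) =
      ∑ k, ∑ l, r ^ 2 * (f k * g l) * ∑ X, Z X k * Z X l := by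
    simp only [Finset.mul_sum (Finset.univ : Finset Ω), Finset.sum_mul_sum]
    rw [Finset.sum_comm]
    refine Finset.sum_congr rfl fun k _ => ?_
    rw [Finset.sum_comm]
    refine Finset.sum_congr rfl fun l _ => Finset.sum_congr rfl fun X _ => ?_
    ring
  rw [hswap, Finset.sum_filter, Finset.mul_sum, Finset.mul_sum]
  refine Finset.sum_congr rfl fun k _ => ?_
  simp only [hZ, ite_and, mul_ite, mul_zero, Finset.sum_ite_eq, Finset.mem_univ, if_true]
  split_ifs
  · field_simp
  · simp

/-- Covariance of the real part at `t₁` and the imaginary part at `t₂` of the centered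
partially sign-fixed OFDM signal, over the uniform random remaining signs:
`E[Re û(t₁) · Im û(t₂)] = (Nσ²)⁻¹ Σ_{k=j+1}^{N-1} Re(b_k e^{iω_k t₁}) Im(b_k e^{iω_k t₂})`
with `ω_k = 2π F_s k / N`. -/
theorem stmt9 (N : ℕ) (b : Fin N → ℂ) (σ Fs : ℝ) (hσ : 0 < σ) (hFs : 0 < Fs)
    (j : ℕ) (hj : j < N) (e : ℝ) (he : e = 1 ∨ e = -1)
    (xstar : Fin j → ℝ) (hxstar : ∀ k, xstar k = 1 ∨ xstar k = -1)
    (Y : (Fin (N - j - 1) → signFS) → Fin N → ℝ)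
    (hY : ∀ X k, Y X k =
      if h : (k : ℕ) < j then xstar ⟨k, h⟩
      else if h2 : (k : ℕ) = j then e
      else (X ⟨(k : ℕ) - j - 1, by have := k.isLt; omega⟩ : ℝ))
    (t₁ t₂ : ℝ) :
    (Fintype.card (Fin (N - j - 1) → signFS) : ℝ)⁻¹ *
      ∑ X : Fin (N - j - 1) → signFS,
        ((uCont N σ Fs (fun k => b k * ((Y X k : ℝ) : ℂ)) t₁ -
            (Fintype.card (Fin (N - j - 1) → signFS) : ℂ)⁻¹ *
              ∑ X' : Fin (N - j - 1) → signFS,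
                uCont N σ Fs (fun k => b k * ((Y X' k : ℝ) : ℂ)) t₁).re *
          (uCont N σ Fs (fun k => b k * ((Y X k : ℝ) : ℂ)) t₂ -
            (Fintype.card (Fin (N - j - 1) → signFS) : ℂ)⁻¹ *
              ∑ X' : Fin (N - j - 1) → signFS,
                uCont N σ Fs (fun k => b k * ((Y X' k : ℝ) : ℂ)) t₂).im)
      = ((N : ℝ) * σ ^ 2)⁻¹ *
          ∑ k ∈ Finset.univ.filter (fun k : Fin N => j < (k : ℕ)),
            (b k * Complex.exp (Complex.I *
                ((2 * Real.pi * Fs * ((k : ℕ) : ℝ) / (N : ℝ) : ℝ) : ℂ) * (t₁ : ℂ))).re *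
            (b k * Complex.exp (Complex.I *
                ((2 * Real.pi * Fs * ((k : ℕ) : ℝ) / (N : ℝ) : ℝ) : ℂ) * (t₂ : ℂ))).im := by
  let Z : (Fin (N - j - 1) → signFS) → Fin N → ℝ := fun X k =>
    if h : j < (k : ℕ) then (X ⟨(k : ℕ) - j - 1, by have := k.isLt; omega⟩ : ℝ) else 0
  let F : Fin N → ℝ := fun k =>
    if h : (k : ℕ) < j then xstar ⟨k, h⟩ else if (k : ℕ) = j then e else 0
  have hYFZ : ∀ X k, Y X k = F k + Z X k := by
    intro X k
    rw [hY]
    rcases lt_trichotomy (k : ℕ) j with h | h | h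
    · simp [F, Z, h, h.le]
    · simp [F, Z, h]
    · simp [F, Z, h, h.not_gt, h.ne']
  have hZ1 : ∀ k, ∑ X, Z X k = 0 := by
    intro k
    by_cases h : j < (k : ℕ)
    · simp only [Z, h, dif_pos]
      exact sum_signs_apply _
    · simp [Z, h]
  have hZ2 : ∀ k l, ∑ X, Z X k * Z X l =
      if k = l ∧ j < (k : ℕ) then (Fintype.card (Fin (N - j - 1) → signFS) : ℝ) else 0 := by
    intro k l
    by_cases hk : j < (k : ℕ)
    · by_cases hl : j < (l : ℕ)
      · simp only [Z, hk, hl, dif_pos, sum_signs_mul, and_true]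
        refine if_congr ?_ rfl rfl
        rw [Fin.mk.injEq, Fin.ext_iff]
        omega
      · have hkl : k ≠ l := by
          rintro rfl
          exact hl hk
        simp [Z, hl, hkl]
    · simp [Z, hk]
  have : Nonempty signFS := ⟨⟨1, by simp [signFS]⟩⟩
  have hr : ((σ * √(N : ℝ))⁻¹) ^ 2 = ((N : ℝ) * σ ^ 2)⁻¹ := by
    rw [inv_pow, mul_pow, Real.sq_sqrt (Nat.cast_nonneg N), mul_comm]
  simp only [uCont_mul_ofReal, hYFZ, sum_sub_average _ F Z hZ1, Complex.re_sum, Complex.im_sum,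
    Complex.re_ofReal_mul, Complex.im_ofReal_mul]
  rw [average_sum_mul_sum (fun k : Fin N => j < (k : ℕ)) _ Z hZ2, hr]
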